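/- arXiv:math/0611262 — 2 statements merged into one kernel-verified Lean document; each statement's English description precedes it below -/
import Mathlib

section
/- Let L = (L_1, ..., L_m) be an ordered family of finite sets and let H = T(L) be its transversal hypergraph. Let v_1 be a vertex of H and let L' be the subfamily of lists of L that contain v_1. Then every minimal edge of H that contains v_1 represents at least one track of L in which v_1 is the element chosen from every list in L'. -/
/-- The edge set of the transversal hypergraph of the ordered family `L`: all
transversals of `L` (within the union of the lists) of cardinality at most `m`. -/
def transversalEdges {α : Type*} [DecidableEq α] {m : ℕ} (L : Fin m → Finset α) :
    Set (Finset α) :=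
  {t | t ⊆ Finset.univ.sup L ∧ t.card ≤ m ∧ ∀ i, (L i ∩ t).Nonempty}

/-- A minimal edge of a hypergraph with edge set `E` is an edge not properly
containing any other edge of `E`. -/
def IsMinimalEdge {α : Type*} (E : Set (Finset α)) (e : Finset α) : Prop :=
  e ∈ E ∧ ∀ f ∈ E, f ⊆ e → f = e

/-- Every minimal edge `e` of the transversal hypergraph of `L` that contains a vertex
`v₁` represents at least one track of `L` in which `v₁` is chosen out of every list
that contains `v₁`. -/
theorem minimal_transversal_track {α : Type*} [DecidableEq α] {m : ℕ}
    (L : Fin m → Finset α) (e : Finset α)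
    (he : IsMinimalEdge (transversalEdges L) e) (v₁ : α) (hv₁ : v₁ ∈ e) :
    ∃ c : Fin m → α, (∀ i, c i ∈ L i) ∧ Finset.image c Finset.univ = e ∧
      ∀ i, v₁ ∈ L i → c i = v₁ := by
  obtain ⟨⟨hsub, -, hmeet⟩, hmin⟩ := he
  choose d hd using hmeet
  let c : Fin m → α := fun i => if v₁ ∈ L i then v₁ else d i
  have hcL : ∀ i, c i ∈ L i := by
    intro i
    by_cases h : v₁ ∈ L i
    · simp [c, h]
    · simpa [c, h] using (Finset.mem_inter.mp (hd i)).1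
  have hce : Finset.image c Finset.univ ⊆ e := by
    intro x hx
    obtain ⟨i, -, rfl⟩ := Finset.mem_image.mp hx
    by_cases h : v₁ ∈ L i
    · simpa [c, h] using hv₁
    · simpa [c, h] using (Finset.mem_inter.mp (hd i)).2
  refine ⟨c, hcL, hmin _ ⟨hce.trans hsub, ?_, fun i => ?_⟩ hce, fun i h => if_pos h⟩
  · simpa using Finset.card_image_le (s := Finset.univ) (f := c)
  · exact ⟨c i, Finset.mem_inter.mpr
      ⟨hcL i, Finset.mem_image_of_mem c (Finset.mem_univ i)⟩⟩
end

section
/- Let L be a family of finite sets and let H = T(L) be its transversal hypergraph. Let v_1 and v_2 be vertices of H such that for every list l ∈ L, v_1 ∈ l if and only if v_2 ∈ l. Then v_1 and v_2 are min-equal in H. -/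
/-- Vertices `a` and `b` are min-equal in the hypergraph with edge set `E` if they are
equal, or if for every minimal edge containing one of them, replacing it by the other
yields a minimal edge. -/
def MinEqual {α : Type*} [DecidableEq α] (E : Set (Finset α)) (a b : α) : Prop :=
  a = b ∨
    ((∀ e, IsMinimalEdge E e → a ∈ e → IsMinimalEdge E (insert b (e.erase a))) ∧
     (∀ e, IsMinimalEdge E e → b ∈ e → IsMinimalEdge E (insert a (e.erase b))))

/-- Replacing `a` by `b` in an edge of the transversal hypergraph yields an edge whenever
every list containing `a` contains `b`. -/
theorem insert_erase_mem_transversalEdges {α : Type*} [DecidableEq α] {m : ℕ}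
    {L : Fin m → Finset α} {a b : α} (hb : b ∈ Finset.univ.sup L)
    (h : ∀ i, a ∈ L i → b ∈ L i) {e : Finset α} (he : e ∈ transversalEdges L) (ha : a ∈ e) :
    insert b (e.erase a) ∈ transversalEdges L := by
  obtain ⟨hsub, hcard, htrans⟩ := he
  refine ⟨Finset.insert_subset hb ((Finset.erase_subset _ _).trans hsub), ?_, fun i => ?_⟩
  · have h₁ := Finset.card_insert_le b (e.erase a)
    have h₂ := Finset.card_erase_add_one ha
    omega
  · obtain ⟨x, hx⟩ := htrans i
    rw [Finset.mem_inter] at hx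
    by_cases hxa : x = a
    · exact ⟨b, by simp [h i (hxa ▸ hx.1)]⟩
    · exact ⟨x, by simp [hx, hxa]⟩

/-- Replacing `a` by `b` in a minimal edge of the transversal hypergraph yields a minimal edge
whenever `a` and `b` are distinct vertices that lie in the same lists. -/
theorem IsMinimalEdge.insert_erase {α : Type*} [DecidableEq α] {m : ℕ}
    {L : Fin m → Finset α} {a b : α} (hab : a ≠ b) (ha : a ∈ Finset.univ.sup L)
    (hb : b ∈ Finset.univ.sup L) (h : ∀ i, a ∈ L i ↔ b ∈ L i) {e : Finset α}
    (he : IsMinimalEdge (transversalEdges L) e) (hae : a ∈ e) :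
    IsMinimalEdge (transversalEdges L) (insert b (e.erase a)) := by
  obtain ⟨hedge, hmin⟩ := he
  have hbe : b ∉ e := fun hbe => by
    have heq := hmin _ (insert_erase_mem_transversalEdges ha (fun i => (h i).2) hedge hbe)
      (Finset.insert_subset hae (Finset.erase_subset _ _))
    have hmem : b ∈ insert a (e.erase b) := heq.symm ▸ hbe
    simp [hab.symm] at hmem
  refine ⟨insert_erase_mem_transversalEdges hb (fun i => (h i).1) hedge hae, fun f hf hfe => ?_⟩
  by_cases hbf : b ∈ f
  · have heq := hmin _ (insert_erase_mem_transversalEdges ha (fun i => (h i).2) hf hbf)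
      (Finset.insert_subset hae fun x hx => by
        have := hfe (Finset.mem_of_mem_erase hx)
        grind)
    have haf : a ∉ f := fun haf => by simpa [hab] using hfe haf
    rw [← heq, Finset.erase_insert (by simp [haf]), Finset.insert_erase hbf]
  · have hfe' : f ⊆ e.erase a := (Finset.subset_insert_iff_of_notMem hbf).1 hfe
    have heq := hmin f hf (hfe'.trans (Finset.erase_subset _ _))
    exact absurd (hfe' (heq.symm ▸ hae)) (Finset.notMem_erase a e)

/-- If `v₁` and `v₂` are vertices of the transversal hypergraph of a family `L` such
that every list of `L` contains `v₁` if and only if it contains `v₂`, then `v₁` and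
`v₂` are min-equal in the transversal hypergraph. -/
theorem minEqual_of_same_lists {α : Type*} [DecidableEq α] {m : ℕ}
    (L : Fin m → Finset α) (v₁ v₂ : α)
    (hv₁ : v₁ ∈ Finset.univ.sup L) (hv₂ : v₂ ∈ Finset.univ.sup L)
    (h : ∀ i, v₁ ∈ L i ↔ v₂ ∈ L i) :
    MinEqual (transversalEdges L) v₁ v₂ := by
  by_cases hne : v₁ = v₂
  · exact Or.inl hne
  · exact Or.inr ⟨fun e he hv => he.insert_erase hne hv₁ hv₂ h hv,
      fun e he hv => he.insert_erase (Ne.symm hne) hv₂ hv₁ (fun i => (h i).symm) hv⟩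
end
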